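/- Let $(f_n)_{n\geq 1}$ be a uniformly integrable sequence of (real-valued measurable) functions on a probability space $(\Omega,\mathcal F,\mathbb P)$. Then there exist functions $g_n \in \operatorname{conv}(f_n, f_{n+1}, \dots)$ (finite convex combinations of $f_n, f_{n+1}, \dots$) such that the sequence $(g_n)_{n\geq 1}$ converges in the norm of $L^1(\mathbb P)$. -/

import Mathlib

open MeasureTheory Filter Set

namespace KomlosL1

/-- The midpoint convexity gap of the strictly convex function `x ↦ √(1 + x ^ 2)`. -/
noncomputable def gap (x y : ℝ) : ℝ :=
  √(1 + x ^ 2) + √(1 + y ^ 2) - 2 * √(1 + ((1 / 2) * x + (1 / 2) * y) ^ 2)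

theorem continuous_gap : Continuous fun p : ℝ × ℝ => gap p.1 p.2 := by
  unfold gap; fun_prop

theorem gap_pos {x y : ℝ} (h : x ≠ y) : 0 < gap x y := by
  unfold gap
  have hx := Real.sq_sqrt (show 0 ≤ 1 + x ^ 2 by positivity)
  have hy := Real.sq_sqrt (show 0 ≤ 1 + y ^ 2 by positivity)
  have hx0 := Real.sqrt_nonneg (1 + x ^ 2)
  have hy0 := Real.sqrt_nonneg (1 + y ^ 2)
  have hxy : 0 < (x - y) ^ 2 := by have := sub_ne_zero.2 h; positivity
  have key : 1 + x * y < √(1 + x ^ 2) * √(1 + y ^ 2) := by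
    rw [← Real.sqrt_mul (by positivity)]
    apply Real.lt_sqrt_of_sq_lt
    nlinarith
  have : √(1 + ((1 / 2) * x + (1 / 2) * y) ^ 2) < (√(1 + x ^ 2) + √(1 + y ^ 2)) / 2 := by
    rw [Real.sqrt_lt' (by positivity)]
    nlinarith
  linarith

theorem gap_nonneg (x y : ℝ) : 0 ≤ gap x y := by
  rcases eq_or_ne x y with rfl | h
  · unfold gap; ring_nf; rfl
  · exact (gap_pos h).le

theorem exists_abs_sub_le {M ε : ℝ} (hε : 0 < ε) :
    ∃ C : ℝ, 0 ≤ C ∧ ∀ x y : ℝ,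
      |x - y| ≤ ε + C * gap x y + 4 * (max (|x| - M) 0 + max (|y| - M) 0) := by
  have hK : IsCompact ((Icc (-(2 * M)) (2 * M) ×ˢ Icc (-(2 * M)) (2 * M)) ∩
      {p : ℝ × ℝ | ε ≤ |p.1 - p.2|}) :=
    (isCompact_Icc.prod isCompact_Icc).inter_right
      (isClosed_le continuous_const (by fun_prop))
  obtain ⟨c, hc, hcK⟩ := hK.exists_forall_le' (a := 0) continuous_gap.continuousOn (by
    rintro ⟨x, y⟩ ⟨-, h⟩
    exact gap_pos (sub_ne_zero.1 (abs_pos.1 (hε.trans_le h))))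
  refine ⟨4 * |M| / c, by positivity, fun x y => ?_⟩
  have hg : 0 ≤ 4 * |M| / c * gap x y := mul_nonneg (by positivity) (gap_nonneg x y)
  have h1 := le_max_left (|x| - M) 0
  have h2 := le_max_left (|y| - M) 0
  have h3 := le_max_right (|x| - M) 0
  have h4 := le_max_right (|y| - M) 0
  have h5 : |x - y| ≤ |x| + |y| := abs_sub x y
  by_cases hx : |x| ≤ 2 * M
  · by_cases hy : |y| ≤ 2 * M
    · by_cases h : ε ≤ |x - y|
      · have := hcK (x, y) ⟨⟨abs_le.1 hx, abs_le.1 hy⟩, h⟩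
        have h6 : 4 * |M| ≤ 4 * |M| / c * gap x y := by
          rw [div_mul_eq_mul_div, le_div_iff₀ hc]
          exact mul_le_mul_of_nonneg_left this (by positivity)
        have := le_abs_self M
        linarith
      · linarith
    · linarith
  · by_cases hy : |y| ≤ |x| <;> linarith

variable {Ω : Type*} {m : MeasurableSpace Ω} {μ : Measure Ω}

theorem integrable_tail [IsFiniteMeasure μ] {g : Ω → ℝ} (hg : Integrable g μ) (M : ℝ) :
    Integrable (fun x => max (|g x| - M) 0) μ :=
  (hg.abs.sub (integrable_const M)).pos_part

theorem integrable_sqrt [IsFiniteMeasure μ] {g : Ω → ℝ} (hg : Integrable g μ) :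
    Integrable (fun x => √(1 + g x ^ 2)) μ := by
  refine ((integrable_const 1).add hg.abs).mono'
    ((by fun_prop : Continuous fun t : ℝ => √(1 + t ^ 2)).comp_aestronglyMeasurable hg.1) ?_
  refine .of_forall fun x => ?_
  rw [Real.norm_of_nonneg (Real.sqrt_nonneg _)]
  refine Real.sqrt_le_iff.2 ⟨by simp; positivity, ?_⟩
  simp only [Pi.add_apply]
  nlinarith [abs_nonneg (g x), sq_abs (g x)]

theorem convex_integrable : Convex ℝ {g : Ω → ℝ | Integrable g μ} :=
  fun _ hu _ hv a b _ _ _ => (hu.smul a).add (hv.smul b)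

theorem convex_tail_le [IsFiniteMeasure μ] (M ε : ℝ) :
    Convex ℝ {g : Ω → ℝ | Integrable g μ ∧ ∫ x, max (|g x| - M) 0 ∂μ ≤ ε} := by
  rintro u ⟨hu, hu'⟩ v ⟨hv, hv'⟩ a b ha hb hab
  have hi : Integrable (a • u + b • v) μ := convex_integrable hu hv ha hb hab
  refine ⟨hi, ?_⟩
  have hle : ∫ x, max (|(a • u + b • v) x| - M) 0 ∂μ ≤
      ∫ x, (a * max (|u x| - M) 0 + b * max (|v x| - M) 0) ∂μ := by
    refine integral_mono (integrable_tail hi M)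
      (((integrable_tail hu M).const_mul a).add ((integrable_tail hv M).const_mul b)) fun x => ?_
    have h1 := mul_le_mul_of_nonneg_left (le_max_left (|u x| - M) 0) ha
    have h2 := mul_le_mul_of_nonneg_left (le_max_left (|v x| - M) 0) hb
    refine max_le ?_ (by positivity)
    have h3 : |a * u x + b * v x| ≤ a * |u x| + b * |v x| := by
      refine (abs_add_le _ _).trans_eq ?_
      rw [abs_mul, abs_mul, abs_of_nonneg ha, abs_of_nonneg hb]
    have h4 : a * M + b * M = M := by rw [← add_mul, hab, one_mul]
    simp only [Pi.add_apply, Pi.smul_apply, smul_eq_mul]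
    linarith
  rw [integral_add ((integrable_tail hu M).const_mul a) ((integrable_tail hv M).const_mul b),
    integral_const_mul, integral_const_mul] at hle
  have h1 := mul_le_mul_of_nonneg_left hu' ha
  have h2 := mul_le_mul_of_nonneg_left hv' hb
  have h3 : a * ε + b * ε = ε := by rw [← add_mul, hab, one_mul]
  linarith

theorem exists_tail_le [IsFiniteMeasure μ] {f : ℕ → Ω → ℝ} (hf : UniformIntegrable f 1 μ)
    {ε : ℝ} (hε : 0 < ε) :
    ∃ M : ℝ, ∀ g ∈ convexHull ℝ (range f),
      Integrable g μ ∧ ∫ x, max (|g x| - M) 0 ∂μ ≤ ε := by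
  obtain ⟨C, hC⟩ := hf.spec one_ne_zero ENNReal.one_ne_top hε
  refine ⟨C, fun g hg => convexHull_min ?_ (convex_tail_le (C : ℝ) ε) hg⟩
  rintro _ ⟨n, rfl⟩
  have hi : Integrable (f n) μ := memLp_one_iff_integrable.1 (hf.memLp n)
  refine ⟨hi, ?_⟩
  rw [← ENNReal.ofReal_le_ofReal_iff hε.le]
  refine le_trans ?_ (hC n)
  rw [ofReal_integral_eq_lintegral_ofReal (integrable_tail hi C)
    (.of_forall fun x => le_max_right _ _), eLpNorm_one_eq_lintegral_enorm]
  refine lintegral_mono fun x => ?_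
  rw [← ofReal_norm]
  refine ENNReal.ofReal_le_ofReal (max_le ?_ (norm_nonneg _))
  by_cases h : C ≤ ‖f n x‖₊
  · rw [indicator_of_mem (by exact h), Real.norm_eq_abs]
    linarith [C.coe_nonneg]
  · have h' : ‖f n x‖ < C := by exact_mod_cast not_le.1 h
    rw [Real.norm_eq_abs] at h'
    linarith [norm_nonneg ({x | C ≤ ‖f n x‖₊}.indicator (f n) x)]

theorem integrable_gap [IsFiniteMeasure μ] {u v : Ω → ℝ} (hu : Integrable u μ)
    (hv : Integrable v μ) : Integrable (fun x => gap (u x) (v x)) μ :=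
  ((integrable_sqrt hu).add (integrable_sqrt hv)).sub
    ((integrable_sqrt ((hu.const_mul (1 / 2)).add (hv.const_mul (1 / 2)))).const_mul 2)

theorem integral_gap [IsFiniteMeasure μ] {u v : Ω → ℝ} (hu : Integrable u μ)
    (hv : Integrable v μ) :
    ∫ x, gap (u x) (v x) ∂μ = ∫ x, √(1 + u x ^ 2) ∂μ + ∫ x, √(1 + v x ^ 2) ∂μ
      - 2 * ∫ x, √(1 + ((1 / 2 : ℝ) • u + (1 / 2 : ℝ) • v) x ^ 2) ∂μ := by
  have hw : Integrable ((1 / 2 : ℝ) • u + (1 / 2 : ℝ) • v) μ := (hu.smul _).add (hv.smul _)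
  have hs : Integrable (fun x => √(1 + u x ^ 2) + √(1 + v x ^ 2)) μ :=
    (integrable_sqrt hu).add (integrable_sqrt hv)
  rw [← integral_const_mul, ← integral_add (integrable_sqrt hu) (integrable_sqrt hv),
    ← integral_sub hs ((integrable_sqrt hw).const_mul 2)]
  rfl

theorem exists_tendsto_integral_gap {K : ℕ → Set (Ω → ℝ)} [IsFiniteMeasure μ]
    (hK : Antitone K) (hconv : ∀ n, Convex ℝ (K n)) (hne : ∀ n, (K n).Nonempty)
    (hint : ∀ n, ∀ g ∈ K n, Integrable g μ)
    {B : ℝ} (hB : ∀ n, ∀ g ∈ K n, ∫ x, √(1 + g x ^ 2) ∂μ ≤ B) :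
    ∃ g : ℕ → Ω → ℝ, (∀ n, g n ∈ K n) ∧ ∃ b : ℕ → ℝ, Tendsto b atTop (nhds 0) ∧
      ∀ n k, n ≤ k → ∫ x, gap (g n x) (g k x) ∂μ ≤ b n := by
  set J : (Ω → ℝ) → ℝ := fun g => ∫ x, √(1 + g x ^ 2) ∂μ with hJ
  have hJ0 : ∀ g, 0 ≤ J g := fun g => integral_nonneg fun x => Real.sqrt_nonneg _
  have hbdd : ∀ n, BddBelow (J '' K n) := fun n => ⟨0, by rintro _ ⟨g, -, rfl⟩; exact hJ0 g⟩
  set I : ℕ → ℝ := fun n => sInf (J '' K n) with hI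
  have hmono : Monotone I := fun n k h =>
    csInf_le_csInf (hbdd n) ((hne k).image J) (image_mono (hK h))
  have hIB : ∀ n, I n ≤ B := fun n => by
    obtain ⟨g, hg⟩ := hne n
    exact (csInf_le (hbdd n) (mem_image_of_mem J hg)).trans (hB n g hg)
  have hIbdd : BddAbove (range I) := ⟨B, by rintro _ ⟨n, rfl⟩; exact hIB n⟩
  have hlim := tendsto_atTop_ciSup hmono hIbdd
  have hex : ∀ n : ℕ, ∃ g ∈ K n, J g < I n + 1 / ((n : ℝ) + 1) := fun n => by
    obtain ⟨_, ⟨g, hg, rfl⟩, h⟩ := exists_lt_of_csInf_lt ((hne n).image J)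
      (lt_add_of_pos_right (I n) (by positivity : 0 < 1 / ((n : ℝ) + 1)))
    exact ⟨g, hg, h⟩
  choose g hg hgI using hex
  refine ⟨g, hg, fun n => (⨆ i, I i) - I n + 2 * (1 / ((n : ℝ) + 1)), ?_, fun n k hnk => ?_⟩
  · simpa using (hlim.const_sub (⨆ i, I i)).add
      (tendsto_one_div_add_atTop_nhds_zero_nat (𝕜 := ℝ) |>.const_mul 2)
  · rw [integral_gap (hint n _ (hg n)) (hint k _ (hg k))]
    have h1 : I n ≤ J ((1 / 2 : ℝ) • g n + (1 / 2 : ℝ) • g k) :=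
      csInf_le (hbdd n) (mem_image_of_mem J
        (hconv n (hg n) (hK hnk (hg k)) (by norm_num) (by norm_num) (by norm_num)))
    have h2 := hgI n
    have h3 := hgI k
    have h4 : I k ≤ ⨆ i, I i := le_ciSup hIbdd k
    have h5 : 1 / ((k : ℝ) + 1) ≤ 1 / ((n : ℝ) + 1) := by gcongr
    simp only [hJ] at h1 h2 h3
    linarith

end KomlosL1

open KomlosL1 in
/-- **Komlós-type lemma in `L¹`.** Given a uniformly integrable sequence `(f n)` of functions
on a probability space, there are finite convex combinations `g n ∈ conv (f n, f (n+1), …)`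
converging in the `L¹`-norm. -/
theorem komlos_L1 {Ω : Type*} {m : MeasurableSpace Ω} (μ : Measure Ω) [IsProbabilityMeasure μ]
    (f : ℕ → Ω → ℝ) (hf : UniformIntegrable f 1 μ) :
    ∃ g : ℕ → Ω → ℝ, (∀ n, g n ∈ convexHull ℝ (f '' Ici n)) ∧
      ∃ h : Ω → ℝ, Tendsto (fun n => eLpNorm (g n - h) 1 μ) atTop (nhds 0) := by
  have hsub : ∀ n, convexHull ℝ (f '' Ici n) ⊆ convexHull ℝ (range f) := fun n =>
    convexHull_mono (image_subset_range _ _)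
  obtain ⟨M₁, hM₁⟩ := exists_tail_le hf one_pos
  have hint : ∀ n, ∀ g ∈ convexHull ℝ (f '' Ici n), Integrable g μ := fun n g hg =>
    (hM₁ g (hsub n hg)).1
  obtain ⟨g, hg, b, hb, hgb⟩ := exists_tendsto_integral_gap
    (μ := μ) (K := fun n => convexHull ℝ (f '' Ici n)) (B := 1 + M₁ + 1)
    (fun n k h => convexHull_mono (image_mono (Ici_subset_Ici.2 h)))
    (fun n => convex_convexHull ℝ _)
    (fun n => ⟨f n, subset_convexHull ℝ _ (mem_image_of_mem f self_mem_Ici)⟩)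
    hint
    (fun n g hg => by
      obtain ⟨hi, ht⟩ := hM₁ g (hsub n hg)
      calc ∫ x, √(1 + g x ^ 2) ∂μ ≤ ∫ x, ((1 + M₁) + max (|g x| - M₁) 0) ∂μ := by
            refine integral_mono (integrable_sqrt hi)
              ((integrable_const _).add (integrable_tail hi M₁)) fun x => ?_
            have h1 : √(1 + g x ^ 2) ≤ 1 + |g x| := Real.sqrt_le_iff.2
              ⟨by positivity, by nlinarith [abs_nonneg (g x), sq_abs (g x)]⟩
            have h2 := le_max_left (|g x| - M₁) 0
            simp only
            linarith
        _ ≤ 1 + M₁ + 1 := by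
            rw [integral_add (integrable_const _) (integrable_tail hi M₁)]
            simpa using ht)
  have hgi : ∀ n, Integrable (g n) μ := fun n => hint n _ (hg n)
  have hcauchy : CauchySeq fun n => (hgi n).toL1 (g n) := by
    refine Metric.cauchySeq_iff'.2 fun ε hε => ?_
    obtain ⟨M, hM⟩ := exists_tail_le hf (ε := ε / 32) (by positivity)
    obtain ⟨C, hC, hCM⟩ := exists_abs_sub_le (M := M) (ε := ε / 4) (by positivity)
    have hlim : Tendsto (fun n => C * b n) atTop (nhds 0) := by simpa using hb.const_mul C
    obtain ⟨N, hN⟩ := (hlim.eventually_lt_const (by positivity : 0 < ε / 4)).exists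
    refine ⟨N, fun n hn => ?_⟩
    rw [dist_comm, dist_eq_norm, ← Integrable.toL1_sub _ _ (hgi N) (hgi n),
      L1.norm_of_fun_eq_integral_norm]
    have ht := fun k => integrable_tail (hgi k) M
    have hG := integrable_gap (hgi N) (hgi n)
    have hG' : Integrable (fun x => ε / 4 + C * gap (g N x) (g n x)) μ :=
      (integrable_const _).add (hG.const_mul C)
    have ht' : Integrable (fun x => 4 * (max (|g N x| - M) 0 + max (|g n x| - M) 0)) μ :=
      ((ht N).add (ht n)).const_mul 4
    calc ∫ x, ‖(g N - g n) x‖ ∂μ ≤ ∫ x, (ε / 4 + C * gap (g N x) (g n x)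
          + 4 * (max (|g N x| - M) 0 + max (|g n x| - M) 0)) ∂μ :=
          integral_mono ((hgi N).sub (hgi n)).norm
            (hG'.add ht') fun x => hCM _ _
      _ = ε / 4 + C * ∫ x, gap (g N x) (g n x) ∂μ
          + 4 * (∫ x, max (|g N x| - M) 0 ∂μ + ∫ x, max (|g n x| - M) 0 ∂μ) := by
          rw [integral_add hG' ht', integral_add (integrable_const _) (hG.const_mul C), integral_const_mul,
            integral_const_mul, integral_add (ht N) (ht n)]
          simp
      _ < ε := by
          have h1 := mul_le_mul_of_nonneg_left (hgb N n hn) hC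
          have h2 := (hM _ (hsub N (hg N))).2
          have h3 := (hM _ (hsub n (hg n))).2
          linarith
  obtain ⟨h, hh⟩ := cauchySeq_tendsto_of_complete hcauchy
  refine ⟨g, hg, h, ?_⟩
  rw [Lp.tendsto_Lp_iff_tendsto_eLpNorm'] at hh
  refine hh.congr fun n => eLpNorm_congr_ae ?_
  exact (hgi n).coeFn_toL1.sub .rfl
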